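/- Let c = (c₁,…,cₙ) ∈ 𝒜⁺ with n ≥ 3, let i ∈ {1,…,n}, and let j ∈ m_i. Then either j is an ear of c (i.e., c_j = 1), or c is fan-shaped. -/

import Mathlib

open Matrix Finset

/-- The matrix `η(a)` with rows `(a, -1)` and `(1, 0)`. -/
def etaM (a : ℤ) : Matrix (Fin 2) (Fin 2) ℤ := !![a, -1; 1, 0]

/-- The set `𝒜⁺` of η-sequences, as an inductive predicate on lists of integers. -/
inductive IsEta : List ℤ → Prop
  | base : IsEta [0, 0]
  | rotate {c : List ℤ} : IsEta c → IsEta (c.rotate 1)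
  | reverse {c : List ℤ} : IsEta c → IsEta c.reverse
  | expand {a b : ℤ} {t : List ℤ} : IsEta (a :: b :: t) → IsEta ((a + 1) :: 1 :: (b + 1) :: t)

/-- The `i`-th entry (1-indexed) of a sequence. -/
def entryOf (c : List ℤ) (i : ℕ) : ℤ := c.getD (i - 1) 0

/-- `φ_i(j)`: `0` if `i = j`; the (2,1)-entry of `η(c_i)⋯η(c_{j-1})` if `i < j`;
the (2,1)-entry of `η(c_j)⋯η(c_{i-1})` if `j < i`.  (Indices are 1-based.) -/
def phi (c : List ℤ) (i j : ℕ) : ℤ :=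
  if i = j then 0
  else if i < j then (((c.drop (i - 1)).take (j - i)).map etaM).prod 1 0
  else (((c.drop (j - 1)).take (i - j)).map etaM).prod 1 0

open Classical in
/-- `m_i`: the set of positions `j ∈ {1,…,n}` where `φ_i` attains its maximum. -/
noncomputable def mset (c : List ℤ) (i : ℕ) : Finset ℕ :=
  (Finset.Icc 1 c.length).filter (fun j => ∀ l ∈ Finset.Icc 1 c.length, phi c i l ≤ phi c i j)

/-- `i ⊕ k`: addition of 1-based indices, wrapping around modulo `n` (for `i + k ≤ 2n`). -/
def addIdx (n i k : ℕ) : ℕ := if i + k ≤ n then i + k else i + k - n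

/-- `c` is dense if for every `i ∈ {1,…,n}`, `|m_i| > 1` or `|m_{i+1}| > 1`
(indices taken cyclically). -/
def DenseSeq (c : List ℤ) : Prop :=
  ∀ i ∈ Finset.Icc 1 c.length,
    1 < (mset c i).card ∨ 1 < (mset c (addIdx c.length i 1)).card

/-- `c` is fan-shaped if a cyclic rotation of `c` equals `(n-2, 1, 2, …, 2, 1)`. -/
def IsFan (c : List ℤ) : Prop :=
  ∃ k, c.rotate k =
    ((c.length : ℤ) - 2) :: 1 :: (List.replicate (c.length - 3) (2 : ℤ) ++ [1])

/-- The product `η(c₁)⋯η(cₙ)`. -/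
def etaProd (c : List ℤ) : Matrix (Fin 2) (Fin 2) ℤ := (c.map etaM).prod

@[simp] lemma etaProd_nil : etaProd [] = 1 := rfl

@[simp] lemma etaProd_cons (a : ℤ) (t : List ℤ) : etaProd (a :: t) = etaM a * etaProd t := by
  simp [etaProd]

@[simp] lemma etaProd_append (s t : List ℤ) : etaProd (s ++ t) = etaProd s * etaProd t := by
  simp [etaProd]

lemma det_etaM (a : ℤ) : (etaM a).det = 1 := by
  simp [etaM, Matrix.det_fin_two]

lemma det_etaProd (c : List ℤ) : (etaProd c).det = 1 := by
  induction c with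
  | nil => simp
  | cons a t ih => rw [etaProd_cons, Matrix.det_mul, det_etaM, ih, one_mul]

lemma etaM_expand (a b : ℤ) : etaM (a + 1) * (etaM 1 * etaM (b + 1)) = etaM a * etaM b := by
  ext i j
  fin_cases i <;> fin_cases j <;> simp [etaM, Matrix.mul_apply, Fin.sum_univ_two]
  ring

/-- The matrix exchanging the two coordinates. -/
def swapM : Matrix (Fin 2) (Fin 2) ℤ := !![0, 1; 1, 0]

lemma swapM_mul_swapM : swapM * swapM = 1 := by
  ext i j
  fin_cases i <;> fin_cases j <;> simp [swapM, Matrix.mul_apply, Fin.sum_univ_two]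

lemma etaM_mul_swapM_mul_etaM (a : ℤ) : etaM a * (swapM * etaM a) = swapM := by
  ext i j
  fin_cases i <;> fin_cases j <;> simp [etaM, swapM, Matrix.mul_apply, Fin.sum_univ_two]

lemma etaProd_mul_swapM_mul_etaProd_reverse (c : List ℤ) :
    etaProd c * (swapM * etaProd c.reverse) = swapM := by
  induction c with
  | nil => simp
  | cons a t ih =>
    calc etaProd (a :: t) * (swapM * etaProd (a :: t).reverse)
        = etaM a * ((etaProd t * (swapM * etaProd t.reverse)) * etaM a) := by
          simp [Matrix.mul_assoc]
      _ = swapM := by rw [ih, etaM_mul_swapM_mul_etaM]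

/-- The first column of a matrix. -/
def firstCol (M : Matrix (Fin 2) (Fin 2) ℤ) : ℤ × ℤ := (M 0 0, M 1 0)

/-- The determinant of the matrix with columns `u` and `v`. -/
def crossDet (u v : ℤ × ℤ) : ℤ := u.1 * v.2 - u.2 * v.1

lemma crossDet_firstCol_mul (M N : Matrix (Fin 2) (Fin 2) ℤ) :
    crossDet (firstCol M) (firstCol (M * N)) = M.det * N 1 0 := by
  simp [crossDet, firstCol, Matrix.mul_apply, Fin.sum_univ_two, Matrix.det_fin_two]
  ring

/-- The first columns of `M`, `M η(c₁)`, …, `M η(c₁)⋯η(cₙ₋₁)`. -/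
def etaWalk : Matrix (Fin 2) (Fin 2) ℤ → List ℤ → List (ℤ × ℤ)
  | _, [] => []
  | M, a :: t => firstCol M :: etaWalk (M * etaM a) t

lemma etaWalk_append (M : Matrix (Fin 2) (Fin 2) ℤ) (s t : List ℤ) :
    etaWalk M (s ++ t) = etaWalk M s ++ etaWalk (M * etaProd s) t := by
  induction s generalizing M with
  | nil => simp [etaWalk]
  | cons a s ih => simp [etaWalk, ih, Matrix.mul_assoc]

lemma firstCol_mem_etaWalk (M : Matrix (Fin 2) (Fin 2) ℤ) (t : List ℤ) (k : ℕ)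
    (hk : k < t.length) : firstCol (M * etaProd (t.take k)) ∈ etaWalk M t := by
  induction t generalizing M k with
  | nil => simp at hk
  | cons a t ih =>
    cases k with
    | zero => simp [etaWalk]
    | succ k =>
      have := ih (M * etaM a) k (by simpa using hk)
      simp [etaWalk, ← Matrix.mul_assoc, this]

lemma etaWalk_reverse (M : Matrix (Fin 2) (Fin 2) ℤ) (c : List ℤ) :
    etaWalk (-(swapM * (M * etaProd c) * swapM)) c.reverse =
      (etaWalk M c).reverse.map Prod.swap := by
  induction c generalizing M with
  | nil => simp [etaWalk]
  | cons a t ih =>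
    have hcol : firstCol (-(swapM * (M * etaM a) * swapM)) = (firstCol M).swap := by
      simp only [firstCol, swapM, etaM, Matrix.neg_apply, Matrix.mul_apply, Fin.sum_univ_two]
      simp
    have hrev : -(swapM * (M * etaM a * etaProd t) * swapM) * etaProd t.reverse =
        -(swapM * (M * etaM a) * swapM) := by
      have := etaProd_mul_swapM_mul_etaProd_reverse t
      simp only [Matrix.mul_assoc, Matrix.neg_mul] at this ⊢
      rw [this]
    rw [etaProd_cons, ← Matrix.mul_assoc M, List.reverse_cons, etaWalk_append, ih, hrev]
    simp [etaWalk, hcol]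

/-- The product over an `η`-sequence is `-1`, and the vectors of its walk turn counterclockwise
within a half-plane. -/
lemma IsEta.pairwise_etaWalk {c : List ℤ} (h : IsEta c) :
    etaProd c = -1 ∧ ∃ M : Matrix (Fin 2) (Fin 2) ℤ, M.det = 1 ∧
      (etaWalk M c).Pairwise fun u v => 0 < crossDet u v := by
  induction h with
  | base =>
    refine ⟨?_, 1, by simp, ?_⟩
    · ext i j
      fin_cases i <;> fin_cases j <;> simp [etaM, Matrix.mul_apply, Fin.sum_univ_two]
    · simp [etaWalk, crossDet, firstCol, etaM]
  | @rotate c _ ih =>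
    obtain ⟨hp, M, hM, hw⟩ := ih
    cases c with
    | nil => exact ⟨by simpa using hp, M, hM, by simp [etaWalk]⟩
    | cons a t =>
      rw [etaProd_cons] at hp
      have hinv : -etaProd t * etaM a = 1 := by
        rw [mul_eq_one_comm, Matrix.mul_neg, hp, neg_neg]
      refine ⟨?_, M * etaM a, by rw [Matrix.det_mul, hM, det_etaM, one_mul], ?_⟩
      · rw [← hinv]; simp
      · simp only [etaWalk, List.pairwise_cons] at hw
        simp only [List.rotate_cons_succ, List.rotate_zero, etaWalk_append, Matrix.mul_assoc, hp,
          etaWalk, List.pairwise_append, hw.2, true_and]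
        refine ⟨by simp, fun u hu v hv => ?_⟩
        have := hw.1 u hu
        rw [List.mem_singleton] at hv
        subst hv
        simp [crossDet, firstCol] at this ⊢
        linarith
  | @reverse c _ ih =>
    obtain ⟨hp, M, hM, hw⟩ := ih
    refine ⟨?_, -(swapM * (M * etaProd c) * swapM), ?_, ?_⟩
    · have := etaProd_mul_swapM_mul_etaProd_reverse c
      rw [hp] at this
      have h2 := congrArg (swapM * ·) this
      simp only [Matrix.neg_mul, Matrix.one_mul, Matrix.mul_neg, ← Matrix.mul_assoc,
        swapM_mul_swapM] at h2
      rw [← h2, neg_neg]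
    · rw [Matrix.det_neg, Matrix.det_mul, Matrix.det_mul, Matrix.det_mul, hM, det_etaProd]
      simp [swapM]
    · rw [etaWalk_reverse, List.pairwise_map, List.pairwise_reverse]
      refine hw.imp fun {u v} huv => ?_
      simp [crossDet] at huv ⊢
      linarith
  | @expand a b t _ ih =>
    obtain ⟨hp, M, hM, hw⟩ := ih
    have hexp : M * etaM (a + 1) * etaM 1 * etaM (b + 1) = M * etaM a * etaM b := by
      rw [Matrix.mul_assoc, Matrix.mul_assoc, etaM_expand, Matrix.mul_assoc]
    have hmid : firstCol (M * etaM (a + 1)) = firstCol M + firstCol (M * etaM a) := by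
      simp [firstCol, etaM, Matrix.mul_apply, Fin.sum_univ_two]
      constructor <;> ring
    have hlast : firstCol (M * etaM (a + 1) * etaM 1) = firstCol (M * etaM a) := by
      simp [firstCol, etaM, Matrix.mul_apply, Fin.sum_univ_two]
      constructor <;> ring
    refine ⟨?_, M, hM, ?_⟩
    · calc etaProd ((a + 1) :: 1 :: (b + 1) :: t)
          = etaM (a + 1) * (etaM 1 * etaM (b + 1)) * etaProd t := by simp [Matrix.mul_assoc]
        _ = -1 := by rw [etaM_expand, ← hp]; simp [Matrix.mul_assoc]
    · simp only [etaWalk, hexp, hmid, hlast, List.pairwise_cons, List.mem_cons, forall_eq_or_imp]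
        at hw ⊢
      obtain ⟨⟨h1, h2⟩, h3, h4⟩ := hw
      generalize firstCol M = u at *
      generalize firstCol (M * etaM a) = v at *
      simp only [crossDet, Prod.fst_add, Prod.snd_add] at *
      refine ⟨⟨by linarith, h1, h2⟩, ⟨by linarith, fun w hw => ?_⟩, h3, h4⟩
      have := h2 w hw
      have := h3 w hw
      linarith

lemma IsEta.rotate_iterate {c : List ℤ} (h : IsEta c) (k : ℕ) : IsEta (c.rotate k) := by
  induction k with
  | zero => simpa
  | succ k ih => rw [← List.rotate_rotate]; exact ih.rotate

lemma IsEta.etaProd_take_pos {c : List ℤ} (h : IsEta c) {k : ℕ} (hk : 0 < k)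
    (hkn : k < c.length) : 0 < etaProd (c.take k) 1 0 := by
  obtain ⟨-, M, hM, hw⟩ := h.pairwise_etaWalk
  obtain _ | ⟨a, t⟩ := c
  · simp at hkn
  obtain _ | k := k
  · simp at hk
  rw [etaWalk, List.pairwise_cons] at hw
  have := hw.1 _ (firstCol_mem_etaWalk (M * etaM a) t k (by simpa using hkn))
  rwa [Matrix.mul_assoc, crossDet_firstCol_mul, hM, one_mul] at this

lemma etaProd_take_succ (s : List ℤ) {k : ℕ} (hk : k < s.length) :
    etaProd (s.take (k + 1)) = etaProd (s.take k) * etaM s[k] := by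
  rw [List.take_succ_eq_append_getElem hk, etaProd_append, etaProd_cons, etaProd_nil,
    Matrix.mul_one]

lemma etaProd_take_succ_apply_zero (s : List ℤ) {k : ℕ} (hk : k < s.length) (r : Fin 2) :
    etaProd (s.take (k + 1)) r 0 = s[k] * etaProd (s.take k) r 0 + etaProd (s.take k) r 1 := by
  rw [etaProd_take_succ s hk]
  simp [etaM, Matrix.mul_apply, Fin.sum_univ_two, mul_comm]

lemma etaProd_take_succ_apply_one (s : List ℤ) {k : ℕ} (hk : k < s.length) (r : Fin 2) :
    etaProd (s.take (k + 1)) r 1 = -etaProd (s.take k) r 0 := by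
  rw [etaProd_take_succ s hk]
  simp [etaM, Matrix.mul_apply, Fin.sum_univ_two]

lemma etaProd_take_add_two (s : List ℤ) {k : ℕ} (hk : k + 1 < s.length) (r : Fin 2) :
    etaProd (s.take (k + 2)) r 0 =
      s[k + 1] * etaProd (s.take (k + 1)) r 0 - etaProd (s.take k) r 0 := by
  rw [etaProd_take_succ_apply_zero s hk, etaProd_take_succ_apply_one s (by omega)]
  ring

/-- The case where all labels `φ₁(j)`, `j ≠ 1`, are equal to `1`. -/
lemma IsEta.eq_fan_of_etaProd_take_eq_one {s : List ℤ} (h : IsEta s) (hn : 3 ≤ s.length)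
    (h1 : ∀ k, 0 < k → k < s.length → etaProd (s.take k) 1 0 = 1) :
    s = ((s.length : ℤ) - 2) :: 1 :: (List.replicate (s.length - 3) (2 : ℤ) ++ [1]) := by
  have hp := h.pairwise_etaWalk.1
  have hfull : etaProd (s.take s.length) = -1 := by rw [List.take_length, hp]
  have hc1 : s[1] = 1 := by
    have := etaProd_take_add_two s (k := 0) (by omega) 1
    rw [h1 2 (by omega) (by omega), h1 1 (by omega) (by omega)] at this
    simp at this
    linarith
  have hmid : ∀ k (hk : k + 1 < s.length), 1 ≤ k → k + 2 < s.length → s[k + 1] = 2 := by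
    intro k hk hk1 hk2
    have := etaProd_take_add_two s hk 1
    rw [h1 (k + 2) (by omega) hk2, h1 (k + 1) (by omega) hk, h1 k (by omega) (by omega)] at this
    linarith
  have hlast : ∀ k (hk : k + 1 < s.length), k + 2 = s.length → s[k + 1] = 1 := by
    intro k hk hk2
    have := etaProd_take_add_two s hk 1
    rw [hk2, hfull, h1 (k + 1) (by omega) hk, h1 k (by omega) (by omega)] at this
    simp at this
    linarith
  have hy : ∀ k, k + 2 < s.length → etaProd (s.take (k + 1)) 0 0 = s[0] - k ∧
      etaProd (s.take (k + 2)) 0 0 = s[0] - (k + 1) := by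
    intro k
    have hy1 : etaProd (s.take 1) 0 0 = s[0] := by
      have := etaProd_take_succ_apply_zero s (k := 0) (by omega) 0
      simpa using this
    induction k with
    | zero =>
      intro _
      have := etaProd_take_add_two s (k := 0) (by omega) 0
      rw [hc1] at this
      simp at this ⊢
      simp [hy1, this]
    | succ k ih =>
      intro hk
      obtain ⟨e1, e2⟩ := ih (by omega)
      have := etaProd_take_add_two s (k := k + 1) (by omega) 0
      rw [hmid (k + 1) (by omega) (by omega) (by omega)] at this
      push_cast
      refine ⟨e2, ?_⟩
      rw [this, e1, e2]
      ring
  have hc0 : s[0] = (s.length : ℤ) - 2 := by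
    obtain ⟨m, hm⟩ : ∃ m, s.length = m + 3 := ⟨s.length - 3, by omega⟩
    have e := etaProd_take_succ_apply_one s (k := m + 2) (by omega) 0
    rw [← hm, hfull, (hy m (by omega)).2] at e
    simp at e
    have hm' : (s.length : ℤ) = m + 3 := by exact_mod_cast hm
    linarith
  apply List.ext_getElem
  · simp
    omega
  · intro k hk hk'
    match k, hk with
    | 0, _ => simpa using hc0
    | 1, _ => simpa using hc1
    | k + 2, hk =>
      simp only [List.getElem_cons_succ, List.getElem_append, List.length_replicate,
        List.getElem_replicate, List.getElem_singleton]
      split_ifs with hlt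
      · exact hmid (k + 1) hk (by omega) (by omega)
      · exact hlast (k + 1) hk (by simp at hk'; omega)

/-- A position maximizing `φ₁` is an ear, or the sequence is a fan. -/
lemma IsEta.getElem_eq_one_or_fan {s : List ℤ} (h : IsEta s) (hn : 3 ≤ s.length) {k : ℕ}
    (hk : k < s.length)
    (hmax : ∀ l < s.length, etaProd (s.take l) 1 0 ≤ etaProd (s.take k) 1 0) :
    s[k] = 1 ∨
      s = ((s.length : ℤ) - 2) :: 1 :: (List.replicate (s.length - 3) (2 : ℤ) ++ [1]) := by
  have hpos := fun {l} => h.etaProd_take_pos (k := l)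
  have hfull : etaProd (s.take s.length) = -1 := by
    rw [List.take_length, h.pairwise_etaWalk.1]
  have hnonneg : ∀ l ≤ s.length, 0 ≤ etaProd (s.take l) 1 0 := by
    intro l hl
    rcases Nat.eq_zero_or_pos l with rfl | hl0
    · simp
    rcases hl.eq_or_lt with rfl | hl
    · rw [hfull]; simp
    · exact (hpos hl0 hl).le
  have hle : ∀ l ≤ s.length, etaProd (s.take l) 1 0 ≤ etaProd (s.take k) 1 0 := by
    intro l hl
    rcases hl.eq_or_lt with rfl | hl
    · rw [hfull]; simpa using hnonneg k hk.le
    · exact hmax l hl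
  obtain _ | k := k
  · have h1 := hpos (l := 1) (by omega) (by omega)
    have h2 := hmax 1 (by omega)
    simp at h1 h2
    omega
  have hrec := etaProd_take_add_two s hk 1
  have hk0 := hpos (l := k + 1) (by omega) hk
  have hprev := hle k (by omega)
  have hnext := hle (k + 2) (by omega)
  have hsum : 0 < etaProd (s.take k) 1 0 + etaProd (s.take (k + 2)) 1 0 := by
    rcases Nat.eq_zero_or_pos k with rfl | hk1
    · have := hpos (l := 0 + 2) (by omega) (by omega)
      have := hnonneg 0 (by omega)
      omega
    · have := hpos hk1 (by omega)
      have := hnonneg (k + 2) (by omega)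
      omega
  have hc_pos : 0 < s[k + 1] := by nlinarith
  have hc_le : s[k + 1] ≤ 2 := by nlinarith
  obtain hc | hc : s[k + 1] = 1 ∨ s[k + 1] = 2 := by omega
  · exact Or.inl hc
  right
  rw [hc] at hrec
  have heq : etaProd (s.take k) 1 0 = etaProd (s.take (k + 1)) 1 0 := by linarith
  have hone : etaProd (s.take (k + 1)) 1 0 = 1 := by
    have hdet := det_etaProd (s.take (k + 1))
    rw [Matrix.det_fin_two, etaProd_take_succ_apply_one s (by omega) 1, heq] at hdet
    have hdvd : etaProd (s.take (k + 1)) 1 0 ∣ 1 :=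
      ⟨-etaProd (s.take (k + 1)) 0 0 - etaProd (s.take (k + 1)) 0 1, by linarith⟩
    exact Int.eq_one_of_dvd_one hk0.le hdvd
  refine h.eq_fan_of_etaProd_take_eq_one hn fun l hl0 hl => ?_
  have := hpos hl0 hl
  have := hle l hl.le
  omega

/-- `φᵢ` of `c` is `φ₁` of the rotation of `c` starting at `i`: indices not wrapping around. -/
lemma phi_add_eq (c : List ℤ) {i k : ℕ} (hk : i + k < c.length) :
    phi c (i + 1) (i + k + 1) = etaProd ((c.rotate i).take k) 1 0 := by
  rw [List.rotate_eq_drop_append_take (by omega),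
    List.take_append_of_le_length (by rw [List.length_drop]; omega)]
  unfold phi
  split_ifs with h1 h2
  · obtain rfl : k = 0 := by omega
    simp
  · rw [show i + k + 1 - (i + 1) = k by omega]
    rfl
  · omega

/-- `φᵢ` of `c` is `φ₁` of the rotation of `c` starting at `i`: indices wrapping around. -/
lemma IsEta.phi_eq_of_lt {c : List ℤ} (h : IsEta c) {i j : ℕ} (hi : i < c.length) (hj : j < i) :
    phi c (i + 1) (j + 1) = etaProd ((c.rotate i).take (c.length - i + j)) 1 0 := by
  have hp := (h.rotate_iterate i).pairwise_etaWalk.1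
  rw [← List.take_append_drop (c.length - i + j) (c.rotate i), etaProd_append] at hp
  have hdrop : (c.rotate i).drop (c.length - i + j) = (c.drop j).take (i - j) := by
    rw [List.rotate_eq_drop_append_take hi.le, List.drop_append]
    have hlen : (c.drop i).length ≤ c.length - i + j := by rw [List.length_drop]; omega
    rw [List.drop_eq_nil_of_le hlen, List.length_drop, List.nil_append, Nat.add_sub_cancel_left,
      List.drop_take]
  have hphi : phi c (i + 1) (j + 1) = etaProd ((c.drop j).take (i - j)) 1 0 := by
    unfold phi
    rw [if_neg (by omega), if_neg (by omega), show i + 1 - (j + 1) = i - j by omega]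
    rfl
  rw [hdrop] at hp
  rw [hphi]
  have hA := det_etaProd ((c.rotate i).take (c.length - i + j))
  generalize etaProd ((c.rotate i).take (c.length - i + j)) = A at *
  generalize etaProd ((c.drop j).take (i - j)) = B at *
  have h00 := congrFun (congrFun hp 0) 0
  have h10 := congrFun (congrFun hp 1) 0
  simp [Matrix.mul_apply, Fin.sum_univ_two, Matrix.det_fin_two] at h00 h10 hA
  linear_combination (-B 1 0) * hA + A 0 0 * h10 - A 1 0 * h00

lemma IsEta.phi_eq {c : List ℤ} (h : IsEta c) {i k : ℕ} (hi : i < c.length) (hk : k < c.length) :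
    phi c (i + 1) ((i + k) % c.length + 1) = etaProd ((c.rotate i).take k) 1 0 := by
  by_cases hik : i + k < c.length
  · rw [Nat.mod_eq_of_lt hik, phi_add_eq c hik]
  · have hmod : (i + k) % c.length = i + k - c.length := by
      rw [Nat.mod_eq_sub_mod (by omega), Nat.mod_eq_of_lt (by omega)]
    rw [hmod, h.phi_eq_of_lt hi (by omega), show c.length - i + (i + k - c.length) = k by omega]

theorem mset_mem_ear_or_fan (c : List ℤ) (h : IsEta c) (hn : 3 ≤ c.length)
    (i : ℕ) (hi : i ∈ Finset.Icc 1 c.length) (j : ℕ) (hj : j ∈ mset c i) :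
    entryOf c j = 1 ∨ IsFan c := by
  obtain ⟨hi1, hin⟩ := Finset.mem_Icc.mp hi
  unfold mset at hj
  obtain ⟨hj', hmax⟩ := (@Finset.mem_filter _ _ (_) _ _).mp hj
  obtain ⟨hj1, hjn⟩ := Finset.mem_Icc.mp hj'
  obtain ⟨i, rfl⟩ : ∃ m, i = m + 1 := ⟨i - 1, by omega⟩
  obtain ⟨k, hk, rfl⟩ : ∃ k < c.length, j = (i + k) % c.length + 1 := by
    by_cases hij : i < j
    · exact ⟨j - 1 - i, by omega, by rw [Nat.mod_eq_of_lt (by omega)]; omega⟩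
    · refine ⟨j - 1 + c.length - i, by omega, ?_⟩
      rw [show i + (j - 1 + c.length - i) = j - 1 + c.length by omega, Nat.add_mod_right,
        Nat.mod_eq_of_lt (by omega)]
      omega
  have hlen : (c.rotate i).length = c.length := List.length_rotate ..
  have key := (h.rotate_iterate i).getElem_eq_one_or_fan (by omega) (k := k) (by omega)
    fun l hl => by
      have hpos : 0 < c.length := by omega
      have := hmax ((i + l) % c.length + 1)
        (Finset.mem_Icc.mpr ⟨by omega, Nat.mod_lt _ hpos⟩)
      rwa [h.phi_eq (by omega) (by omega), h.phi_eq (by omega) hk] at this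
  refine key.imp (fun hc => ?_) fun hc => ⟨i, by rwa [hlen] at hc⟩
  rw [List.getElem_rotate] at hc
  have hlt : (i + k) % c.length < c.length := Nat.mod_lt _ (by omega)
  rw [entryOf, Nat.add_sub_cancel, List.getD_eq_getElem _ _ hlt, ← hc]
  simp only [Nat.add_comm]
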